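/- Define F₂ : [0,∞) → ℝ by F₂(z₁) = (24/π⁴) ∫_{z₂=−z₁}^{z₁} ∫_{𝒲'} ∫_𝔉 1[𝓛h ∩ (T(z₁²·θ̂) × 𝒲) = ∅] dx₁ dx₂ dw dz₂, where for z₁ > 0 the matrix h = h(x₁,x₂,y₁,y₂,θ₁,θ₂) has parameters y₁ > 0, θ₁ determined by y₁⁻¹(sin θ₁, cos θ₁) = (z₁, z₂) and y₂ > 0, θ₂ determined by y₂⁻¹(sin θ₂, cos θ₂) = w, and F₂(0) = 0. Then F₂ is continuous at every z₁ ≥ 0. -/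

import Mathlib

open MeasureTheory Matrix Set Pointwise

noncomputable section

/-- The real embedding of `ℤ[√2]`, `a + b√2 ↦ a + b√2`. -/
def emb (α : Zsqrtd 2) : ℝ := (α.re : ℝ) + (α.im : ℝ) * Real.sqrt 2

/-- The Galois-conjugate embedding `σ`, `a + b√2 ↦ a − b√2`. -/
def embc (α : Zsqrtd 2) : ℝ := (α.re : ℝ) - (α.im : ℝ) * Real.sqrt 2

/-- The fundamental unit `λ = 1 + √2`. -/
def lam : ℝ := 1 + Real.sqrt 2

/-- `𝓛'`: the Minkowski embedding of `ℤ[√2]` in `ℝ²`. -/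
def Lp : Set (ℝ × ℝ) := {p | ∃ α : Zsqrtd 2, p = (emb α, embc α)}

/-- `v(β₁,β₂) = (β₁, β₂, σ(β₁), σ(β₂))`. -/
def latvec (β₁ β₂ : Zsqrtd 2) : Fin 4 → ℝ := ![emb β₁, emb β₂, embc β₁, embc β₂]

/-- `𝓛`: the Minkowski embedding of `ℤ[√2]²` in `ℝ⁴`. -/
def Lquad : Set (Fin 4 → ℝ) := {v | ∃ β₁ β₂ : Zsqrtd 2, v = latvec β₁ β₂}

/-- `𝓛h`, for a 4×4 real matrix `h` (row vectors, right multiplication). -/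
def latimage (h : Matrix (Fin 4) (Fin 4) ℝ) : Set (Fin 4 → ℝ) :=
  (fun v => Matrix.vecMul v h) '' Lquad

def nmat (x : ℝ) : Matrix (Fin 2) (Fin 2) ℝ := !![1, x; 0, 1]
def amat (y : ℝ) : Matrix (Fin 2) (Fin 2) ℝ := !![y, 0; 0, y⁻¹]
def kmat (θ : ℝ) : Matrix (Fin 2) (Fin 2) ℝ :=
  !![Real.cos θ, -Real.sin θ; Real.sin θ, Real.cos θ]

/-- Block diagonal 4×4 matrix from two 2×2 blocks. -/
def bd (A B : Matrix (Fin 2) (Fin 2) ℝ) : Matrix (Fin 4) (Fin 4) ℝ :=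
  !![A 0 0, A 0 1, 0, 0;
     A 1 0, A 1 1, 0, 0;
     0, 0, B 0 0, B 0 1;
     0, 0, B 1 0, B 1 1]

/-- `h(x₁,x₂,y₁,y₂,θ₁,θ₂) = diag(n(x₁)a(y₁)k(θ₁), n(x₂)a(y₂)k(θ₂))`. -/
def hmat (x₁ x₂ y₁ y₂ θ₁ θ₂ : ℝ) : Matrix (Fin 4) (Fin 4) ℝ :=
  bd (nmat x₁ * amat y₁ * kmat θ₁) (nmat x₂ * amat y₂ * kmat θ₂)

/-- `H = SL₂(ℝ)² ⊂ SL₄(ℝ)` (block diagonal). -/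
def Hset : Set (Matrix (Fin 4) (Fin 4) ℝ) :=
  {h | ∃ A B : Matrix (Fin 2) (Fin 2) ℝ, A.det = 1 ∧ B.det = 1 ∧ h = bd A B}

/-- `Γ_K = {diag(A, σ(A)) : A ∈ SL₂(ℤ[√2])}`. -/
def GammaK : Set (Matrix (Fin 4) (Fin 4) ℝ) :=
  {g | ∃ A : Matrix (Fin 2) (Fin 2) (Zsqrtd 2), A.det = 1 ∧ g = bd (A.map emb) (A.map embc)}

/-- `𝒲`: the open regular octagon of side length √2. -/
def Woct : Set (ℝ × ℝ) :=
  {p | |p.1| < lam / Real.sqrt 2 ∧ |p.2| < lam / Real.sqrt 2 ∧ |p.1| + |p.2| < lam}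

/-- `𝒲' = 𝒲 ∖ (√2−1)𝒲`. -/
def Wp : Set (ℝ × ℝ) := Woct \ ((Real.sqrt 2 - 1) • Woct)

/-- `θ̂ = 48√2/π⁴`, the density of visible points. -/
def thetaHat : ℝ := 48 * Real.sqrt 2 / Real.pi ^ 4

/-- `T(s)`: open triangle with vertices `(0,0)`, `(s/θ̂)^{1/2}(1,±1)`. -/
def Tset (s : ℝ) : Set (ℝ × ℝ) :=
  {p | 0 < p.1 ∧ p.1 < Real.sqrt (s / thetaHat) ∧ |p.2| < p.1}

/-- `𝔉`: a fundamental domain of `𝓛'`. -/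
def Fdom : Set (ℝ × ℝ) :=
  {p | ∃ r₁ ∈ Set.Ico (0:ℝ) 1, ∃ r₂ ∈ Set.Ico (0:ℝ) 1,
    p = (1 + r₁ + r₂ * Real.sqrt 2, 2 + r₁ - r₂ * Real.sqrt 2)}

/-- The Siegel domain `𝔇_t`. -/
def Dset (t : ℝ) : Set (Matrix (Fin 4) (Fin 4) ℝ) :=
  {h | ∃ x₁ x₂ y₁ y₂ θ₁ θ₂ : ℝ, (x₁, x₂) ∈ Fdom ∧ 0 < y₁ ∧ 0 < y₂ ∧ t ≤ y₁ * y₂ ∧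
    lam ^ (-2 : ℤ) ≤ y₁ / y₂ ∧ y₁ / y₂ ≤ lam ^ 2 ∧
    θ₁ ∈ Set.Ico 0 Real.pi ∧ θ₂ ∈ Set.Ico 0 Real.pi ∧ h = hmat x₁ x₂ y₁ y₂ θ₁ θ₂}

/-- Row vector times 2×2 matrix, on `ℝ × ℝ`. -/
def mul2 (p : ℝ × ℝ) (M : Matrix (Fin 2) (Fin 2) ℝ) : ℝ × ℝ :=
  (p.1 * M 0 0 + p.2 * M 1 0, p.1 * M 0 1 + p.2 * M 1 1)

/-- `r(s)`: the unique integer with `λ^{2r} ≤ s^{1/4} < λ^{2(r+1)}`. -/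
def rr (s : ℝ) : ℤ := ⌊Real.logb (lam ^ 2) (s ^ ((1:ℝ)/4))⌋

/-- `𝒯(s)` with explicit integer `r`: `λ^{−2r}T(s) × λ^{2r}𝒲`. -/
def calT (s : ℝ) (r : ℤ) : Set (Fin 4 → ℝ) :=
  {v | (lam ^ (2*r) * v 0, lam ^ (2*r) * v 1) ∈ Tset s ∧
       (lam ^ (-(2*r)) * v 2, lam ^ (-(2*r)) * v 3) ∈ Woct}

/-- `𝒯(s) = λ^{−2r(s)}T(s) × λ^{2r(s)}𝒲`. -/
def calTs (s : ℝ) : Set (Fin 4 → ℝ) := calT s (rr s)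

/-- Euclidean norm on `ℝ⁴`. -/
def enorm4 (v : Fin 4 → ℝ) : ℝ := Real.sqrt (∑ i, (v i) ^ 2)

/-- `𝓛h̃ = (ℤ(y₁,0,y₂,0) + ℤ√2(y₁,0,−y₂,0) + ℝ(0,1,0,0) + ℝ(0,0,0,1))·diag(k(θ₁),k(θ₂))`. -/
def Ltilde (y₁ y₂ θ₁ θ₂ : ℝ) : Set (Fin 4 → ℝ) :=
  {v | ∃ (m n : ℤ) (c₁ c₂ : ℝ),
    v = Matrix.vecMul ![((m:ℝ) + (n:ℝ) * Real.sqrt 2) * y₁, c₁,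
          ((m:ℝ) - (n:ℝ) * Real.sqrt 2) * y₂, c₂] (bd (kmat θ₁) (kmat θ₂))}

open Classical in
/-- Real-valued indicator of a proposition. -/
def ind (P : Prop) : ℝ := if P then 1 else 0

/-- `c_H = 3/π⁴`. -/
def cH : ℝ := 3 / Real.pi ^ 4

/-- `Y_t = {(y₁,y₂) : y₁,y₂ > 0, y₁y₂ ≥ t, y₁/y₂ ∈ (λ⁻²,λ²)}`. -/
def Yt (t : ℝ) : Set (ℝ × ℝ) :=
  {y | 0 < y.1 ∧ 0 < y.2 ∧ t ≤ y.1 * y.2 ∧ lam ^ (-2:ℤ) < y.1 / y.2 ∧ y.1 / y.2 < lam ^ 2}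

/-- The main term `G_M(s)` (depending on the Siegel-domain parameter `t`). -/
def GM (t s : ℝ) : ℝ :=
  cH * ∫ θ₂ in Set.Ico (0:ℝ) Real.pi, ∫ θ₁ in Set.Ico (0:ℝ) Real.pi, ∫ y in Yt t, ∫ x in Fdom,
    (y.1 ^ 3 * y.2 ^ 3)⁻¹ * ind (Ltilde y.1 y.2 θ₁ θ₂ ∩ calTs s = ∅)

/-- The error term `G_E(s)`. -/
def GE (t s : ℝ) : ℝ :=
  cH * ∫ θ₂ in Set.Ico (0:ℝ) Real.pi, ∫ θ₁ in Set.Ico (0:ℝ) Real.pi, ∫ y in Yt t, ∫ x in Fdom,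
    (y.1 ^ 3 * y.2 ^ 3)⁻¹ *
      ind (latimage (hmat x.1 x.2 y.1 y.2 θ₁ θ₂) ∩ calTs s = ∅ ∧
           (Ltilde y.1 y.2 θ₁ θ₂ ∩ calTs s).Nonempty)

/-- `J = [0,π/4] ∪ [3π/4,π)`. -/
def Jset : Set ℝ := Set.Icc 0 (Real.pi/4) ∪ Set.Ico (3*Real.pi/4) Real.pi

/-- `Y = {(y₁,y₂) : y₁ > 0, 1 < y₂ < λ²}`. -/
def Yset : Set (ℝ × ℝ) := {y | 0 < y.1 ∧ 1 < y.2 ∧ y.2 < lam ^ 2}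

/-- `T₁`: open triangle with vertices `(0,0)`, `(1,±1)`. -/
def T1 : Set (ℝ × ℝ) := {p | 0 < p.1 ∧ p.1 < 1 ∧ |p.2| < p.1}

/-- `ℓ₁(θ₁)`: first-coordinate projection of `θ̂^{−1/2}T₁k(−θ₁)`. -/
def ell1 (θ₁ : ℝ) : Set ℝ :=
  {x | ∃ p ∈ T1, x = (mul2 ((Real.sqrt thetaHat)⁻¹ • p) (kmat (-θ₁))).1}

/-- `ℓ₂(θ₂)`: first-coordinate projection of `𝒲k(−θ₂)`. -/
def ell2 (θ₂ : ℝ) : Set ℝ := {x | ∃ p ∈ Woct, x = (mul2 p (kmat (-θ₂))).1}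

/-- `C_𝒫 = 2304(2−√2)/π⁸`. -/
def CP : ℝ := 2304 * (2 - Real.sqrt 2) / Real.pi ^ 8

/-- `ζ_K(2) = π⁴/(48√2)`. -/
def zetaK2 : ℝ := Real.pi ^ 4 / (48 * Real.sqrt 2)

/-- `𝒯'(s) = T(s) × 𝒲`. -/
def Tprime (s : ℝ) : Set (Fin 4 → ℝ) :=
  {v | (v 0, v 1) ∈ Tset s ∧ (v 2, v 3) ∈ Woct}

/-- `L₁(θ₁)` from Lemma 3.4: projection of `λ^{−2r}T(s)k(−θ₁)` onto the x-axis. -/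
def L1set (s : ℝ) (r : ℤ) (θ₁ : ℝ) : Set ℝ :=
  {x | ∃ p ∈ Tset s, x = (mul2 ((lam ^ (-(2*r)) : ℝ) • p) (kmat (-θ₁))).1}

/-- `L₂(θ₂)`: projection of `λ^{2r}𝒲k(−θ₂)` onto the x-axis. -/
def L2set (r : ℤ) (θ₂ : ℝ) : Set ℝ :=
  {x | ∃ p ∈ Woct, x = (mul2 ((lam ^ (2*r) : ℝ) • p) (kmat (-θ₂))).1}

/-- `n(x)a(y)k(θ)` where `y,θ` are determined by `y⁻¹(sin θ, cos θ) = z`. -/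
def hz (z : ℝ × ℝ) (x : ℝ) : Matrix (Fin 2) (Fin 2) ℝ :=
  nmat x * amat (Real.sqrt (z.1 ^ 2 + z.2 ^ 2))⁻¹ *
    !![(Real.sqrt (z.1 ^ 2 + z.2 ^ 2))⁻¹ * z.2, -((Real.sqrt (z.1 ^ 2 + z.2 ^ 2))⁻¹ * z.1);
       (Real.sqrt (z.1 ^ 2 + z.2 ^ 2))⁻¹ * z.1, (Real.sqrt (z.1 ^ 2 + z.2 ^ 2))⁻¹ * z.2]

/-- The function `F₂` of Lemma 4.7. -/
def F2 (z₁ : ℝ) : ℝ :=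
  (24 / Real.pi ^ 4) * ∫ z₂ in Set.Ioo (-z₁) z₁, ∫ w in Wp, ∫ x in Fdom,
    ind (latimage (bd (hz (z₁, z₂) x.1) (hz w x.2)) ∩ Tprime (z₁ ^ 2 * thetaHat) = ∅)

/-- The box `B(α₃,α₄)`. -/
def Bbox (α₃ α₄ : Zsqrtd 2) (C₁ s : ℝ) : Set (ℝ × ℝ) :=
  {x | |x.1 + emb α₄ / emb α₃| ≤ C₁ / Real.sqrt s ∧
       |x.2 + embc α₄ / embc α₃| ≤ C₁ / Real.sqrt s}

/-- The matrix `h` determined by `s, z₂, w, x₁, x₂` via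
`y₁⁻¹(sin θ₁, cos θ₁) = λ^{−2r}(θ̂^{−1/2}s^{1/2}, z₂)`, `y₂⁻¹(sin θ₂, cos θ₂) = λ^{2r}w`. -/
def hfull (s z₂ : ℝ) (w : ℝ × ℝ) (x₁ x₂ : ℝ) : Matrix (Fin 4) (Fin 4) ℝ :=
  bd (hz ((lam ^ (-(2 * rr s)) : ℝ) • (Real.sqrt (s / thetaHat), z₂)) x₁)
     (hz ((lam ^ (2 * rr s) : ℝ) • w) x₂)

/-- `F⁺_{(α₃,α₄)}(s)`. -/
def Fplus (α₃ α₄ : Zsqrtd 2) (C₁ s : ℝ) : ℝ :=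
  (Real.sqrt s)⁻¹ * ∫ z₂ in Set.Ioo (0:ℝ) (Real.sqrt (s / thetaHat)), ∫ w in Wp,
    ∫ x in Bbox α₃ α₄ C₁ s, ind (latimage (hfull s z₂ w x.1 x.2) ∩ calTs s = ∅)

/-- `F⁻_{(α₃,α₄)}(s)`. -/
def Fminus (α₃ α₄ : Zsqrtd 2) (C₁ s : ℝ) : ℝ :=
  (Real.sqrt s)⁻¹ * ∫ z₂ in Set.Ioo (-Real.sqrt (s / thetaHat)) (0:ℝ), ∫ w in Wp,
    ∫ x in Bbox α₃ α₄ C₁ s, ind (latimage (hfull s z₂ w x.1 x.2) ∩ calTs s = ∅)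

/-- `F_{(α₃,α₄)}(s)`. -/
def Ffull (α₃ α₄ : Zsqrtd 2) (C₁ s : ℝ) : ℝ :=
  (Real.sqrt s)⁻¹ *
    ∫ z₂ in Set.Ioo (-Real.sqrt (s / thetaHat)) (Real.sqrt (s / thetaHat)), ∫ w in Wp,
      ∫ x in Bbox α₃ α₄ C₁ s, ind (latimage (hfull s z₂ w x.1 x.2) ∩ calTs s = ∅)

/-- `v₁ = (α₃, α₄, σ(α₃), σ(α₄))`. -/
def vv1 (α₃ α₄ : Zsqrtd 2) : Fin 4 → ℝ := ![emb α₃, emb α₄, embc α₃, embc α₄]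

/-- `v₂ = (√2α₃, √2α₄, −√2σ(α₃), −√2σ(α₄))`. -/
def vv2 (α₃ α₄ : Zsqrtd 2) : Fin 4 → ℝ :=
  ![Real.sqrt 2 * emb α₃, Real.sqrt 2 * emb α₄,
    -(Real.sqrt 2 * embc α₃), -(Real.sqrt 2 * embc α₄)]

/-- `b₁ = (α₃, α₄, 0, 0)`. -/
def bb1 (α₃ α₄ : Zsqrtd 2) : Fin 4 → ℝ := ![emb α₃, emb α₄, 0, 0]

/-- `b₂ = (0, 0, σ(α₃), σ(α₄))`. -/
def bb2 (α₃ α₄ : Zsqrtd 2) : Fin 4 → ℝ := ![0, 0, embc α₃, embc α₄]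

/-- The subgrid `𝓛_v = v + ℤv₁ + ℤv₂`. -/
def Lv (α₃ α₄ : Zsqrtd 2) (v : Fin 4 → ℝ) : Set (Fin 4 → ℝ) :=
  {u | ∃ m n : ℤ, u = v + (m:ℝ) • vv1 α₃ α₄ + (n:ℝ) • vv2 α₃ α₄}

/-- The filled plane `Π_v = v + ℝb₁ + ℝb₂`. -/
def Piv (α₃ α₄ : Zsqrtd 2) (v : Fin 4 → ℝ) : Set (Fin 4 → ℝ) :=
  {u | ∃ c₁ c₂ : ℝ, u = v + c₁ • bb1 α₃ α₄ + c₂ • bb2 α₃ α₄}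

/-- `d(s) = θ̂^{−1/2}λ^{−2r}s^{1/2}`. -/
def ds (s : ℝ) : ℝ := lam ^ (-(2 * rr s)) * Real.sqrt (s / thetaHat)

/-- The explicit integral representation `Φ(s)` of the limiting gap distribution `F(s)`. -/
def Phi (s : ℝ) : ℝ :=
  (1 / ((2:ℝ) ^ ((11:ℝ)/2) * Real.sqrt thetaHat * zetaK2 * Real.sqrt s)) *
    ∫ z₂ in Set.Ioo (-Real.sqrt (s / thetaHat)) (Real.sqrt (s / thetaHat)), ∫ w in Wp,
      ∫ x in Fdom, ind (latimage (hfull s z₂ w x.1 x.2) ∩ calTs s = ∅)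

theorem hz_eq (z : ℝ × ℝ) (x : ℝ) :
    hz z x = !![z.2 / (z.1 ^ 2 + z.2 ^ 2) + x * z.1, -(z.1 / (z.1 ^ 2 + z.2 ^ 2)) + x * z.2;
      z.1, z.2] := by
  obtain ⟨a, b⟩ := z
  rcases eq_or_ne (a ^ 2 + b ^ 2) 0 with h | h
  · have ha : a = 0 := by nlinarith [sq_nonneg a, sq_nonneg b]
    have hb : b = 0 := by nlinarith [sq_nonneg a, sq_nonneg b]
    subst ha hb
    ext i j
    fin_cases i <;> fin_cases j <;> simp [hz, nmat, amat, Matrix.mul_apply]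
  · have hpos : 0 < a ^ 2 + b ^ 2 := lt_of_le_of_ne (by positivity) h.symm
    have hr : Real.sqrt (a ^ 2 + b ^ 2) ≠ 0 := (Real.sqrt_pos.2 hpos).ne'
    have hsq : Real.sqrt (a ^ 2 + b ^ 2) ^ 2 = a ^ 2 + b ^ 2 := Real.sq_sqrt hpos.le
    have hinv : (Real.sqrt (a ^ 2 + b ^ 2))⁻¹ ^ 2 = (a ^ 2 + b ^ 2)⁻¹ := by rw [inv_pow, hsq]
    ext i j
    fin_cases i <;> fin_cases j <;> simp [hz, nmat, amat, Matrix.mul_apply, hr]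
    · rw [div_eq_mul_inv, ← hinv]; field_simp
    · rw [div_eq_mul_inv, ← hinv]; field_simp

/-- First coordinate of the physical component of a lattice vector, divided by `t`. -/
def scaledFst (t u x : ℝ) (β : Zsqrtd 2 × Zsqrtd 2) : ℝ :=
  emb β.1 * (u / (t ^ 2 * (1 + u ^ 2)) + x) + emb β.2

/-- Second coordinate of the physical component of a lattice vector, divided by `t`. -/
def scaledSnd (t u x : ℝ) (β : Zsqrtd 2 × Zsqrtd 2) : ℝ :=
  emb β.1 * (-(1 / (t ^ 2 * (1 + u ^ 2))) + x * u) + emb β.2 * u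

/-- The rescaled physical component lies in the unit triangle. -/
def InTriangle (t u x : ℝ) (β : Zsqrtd 2 × Zsqrtd 2) : Prop :=
  0 < scaledFst t u x β ∧ scaledFst t u x β < 1 ∧ |scaledSnd t u x β| < scaledFst t u x β

/-- The internal component of a lattice vector. -/
def internalPart (w : ℝ × ℝ) (x : ℝ) (β : Zsqrtd 2 × Zsqrtd 2) : ℝ × ℝ :=
  (embc β.1 * (w.2 / (w.1 ^ 2 + w.2 ^ 2) + x * w.1) + embc β.2 * w.1,
   embc β.1 * (-(w.1 / (w.1 ^ 2 + w.2 ^ 2)) + x * w.2) + embc β.2 * w.2)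

/-- Some lattice vector lies in the product of the unit triangle and the octagon. -/
def Hits (t u : ℝ) (w x : ℝ × ℝ) : Prop :=
  ∃ β, InTriangle t u x.1 β ∧ internalPart w x.2 β ∈ Woct

theorem thetaHat_pos : 0 < thetaHat := by
  unfold thetaHat
  positivity

theorem vecMul_latvec_bd (β₁ β₂ : Zsqrtd 2) (A B : Matrix (Fin 2) (Fin 2) ℝ) :
    Matrix.vecMul (latvec β₁ β₂) (bd A B) =
      ![emb β₁ * A 0 0 + emb β₂ * A 1 0, emb β₁ * A 0 1 + emb β₂ * A 1 1,
        embc β₁ * B 0 0 + embc β₂ * B 1 0, embc β₁ * B 0 1 + embc β₂ * B 1 1] := by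
  ext i
  fin_cases i <;> simp [Matrix.vecMul, dotProduct, latvec, bd, Fin.sum_univ_four]

theorem inter_Tprime_eq_empty_iff {t : ℝ} (ht : 0 < t) (u : ℝ) (w x : ℝ × ℝ) :
    latimage (bd (hz (t, t * u) x.1) (hz w x.2)) ∩ Tprime (t ^ 2 * thetaHat) = ∅ ↔
      ¬ Hits t u w x := by
  rw [← Set.not_nonempty_iff_eq_empty, not_iff_not]
  have hs : Real.sqrt (t ^ 2 * thetaHat / thetaHat) = t := by
    rw [mul_div_cancel_right₀ _ thetaHat_pos.ne', Real.sqrt_sq ht.le]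
  have hu : (1 + u ^ 2) ≠ 0 := by positivity
  have key : ∀ β : Zsqrtd 2 × Zsqrtd 2,
      Matrix.vecMul (latvec β.1 β.2) (bd (hz (t, t * u) x.1) (hz w x.2)) ∈
        Tprime (t ^ 2 * thetaHat) ↔ InTriangle t u x.1 β ∧ internalPart w x.2 β ∈ Woct := by
    intro β
    have h1 : emb β.1 * (t * u / (t ^ 2 + (t * u) ^ 2) + x.1 * t) + emb β.2 * t =
        t * scaledFst t u x.1 β := by
      have : t ^ 2 + (t * u) ^ 2 = t ^ 2 * (1 + u ^ 2) := by ring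
      rw [this, scaledFst]
      field_simp
    have h2 : emb β.1 * (-(t / (t ^ 2 + (t * u) ^ 2)) + x.1 * (t * u)) + emb β.2 * (t * u) =
        t * scaledSnd t u x.1 β := by
      have : t ^ 2 + (t * u) ^ 2 = t ^ 2 * (1 + u ^ 2) := by ring
      rw [this, scaledSnd]
      field_simp
    rw [vecMul_latvec_bd, hz_eq, hz_eq]
    simp only [Tprime, Tset, Set.mem_ofPred_eq, hs]
    simp only [Matrix.of_apply, Matrix.cons_val, Matrix.cons_val_zero, Matrix.cons_val_one]
    rw [h1, h2, abs_mul, abs_of_pos ht]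
    refine and_congr ?_ Iff.rfl
    simp [InTriangle, ht, mul_lt_mul_iff_right₀ ht]
  constructor
  · rintro ⟨_, ⟨_, ⟨β₁, β₂, rfl⟩, rfl⟩, h⟩
    exact ⟨(β₁, β₂), (key (β₁, β₂)).1 h⟩
  · rintro ⟨β, h⟩
    exact ⟨_, ⟨_, ⟨β.1, β.2, rfl⟩, rfl⟩, (key β).2 h⟩

theorem Zsqrtd.injective_re_im {d : ℤ} :
    Function.Injective (fun α : Zsqrtd d => (α.re, α.im)) := by
  intro a b h
  simp only [Prod.mk.injEq] at h
  exact Zsqrtd.ext h.1 h.2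

theorem finite_setOf_abs_emb_le (M : ℝ) : {α : Zsqrtd 2 | |emb α| ≤ M ∧ |embc α| ≤ M}.Finite := by
  refine Set.Finite.of_finite_image (f := fun α : Zsqrtd 2 => (α.re, α.im)) ?_
    Zsqrtd.injective_re_im.injOn
  refine ((Set.finite_Icc (-⌈M⌉) ⌈M⌉).prod (Set.finite_Icc (-⌈M⌉) ⌈M⌉)).subset ?_
  rintro _ ⟨α, ⟨h1, h2⟩, rfl⟩
  rw [abs_le, emb] at h1
  rw [abs_le, embc] at h2
  have hs : 1 ≤ Real.sqrt 2 := Real.one_le_sqrt.2 (by norm_num)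
  have hre : |(α.re : ℝ)| ≤ M := abs_le.2 ⟨by linarith, by linarith⟩
  have him : |(α.im : ℝ)| ≤ M := by
    have h : |(α.im : ℝ) * Real.sqrt 2| ≤ M := abs_le.2 ⟨by linarith, by linarith⟩
    rw [abs_mul, abs_of_pos (by linarith : 0 < Real.sqrt 2)] at h
    nlinarith [abs_nonneg (α.im : ℝ)]
  have int_mem : ∀ n : ℤ, |(n : ℝ)| ≤ M → n ∈ Set.Icc (-⌈M⌉) ⌈M⌉ := by
    intro n hn
    rw [Set.mem_Icc, ← abs_le]
    have : ((|n| : ℤ) : ℝ) ≤ (⌈M⌉ : ℝ) := by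
      rw [Int.cast_abs]
      exact hn.trans (Int.le_ceil M)
    exact_mod_cast this
  exact ⟨int_mem _ hre, int_mem _ him⟩

theorem emb_zero : emb 0 = 0 := by
  simp [emb]

theorem emb_ne_zero {α : Zsqrtd 2} (hα : α ≠ 0) : emb α ≠ 0 := by
  intro h
  apply hα
  unfold emb at h
  by_cases him : α.im = 0
  · have hre : α.re = 0 := by
      rw [him] at h
      simpa using h
    exact Zsqrtd.ext hre him
  · have him' : (α.im : ℝ) ≠ 0 := by exact_mod_cast him
    refine absurd ?_ (irrational_sqrt_two.ne_rat (-α.re / α.im))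
    push_cast
    rw [eq_div_iff him']
    linarith

theorem norm_lt_of_mem_Woct {p : ℝ × ℝ} (hp : p ∈ Woct) : |p.1| < lam ∧ |p.2| < lam := by
  obtain ⟨-, -, h⟩ := hp
  exact ⟨by linarith [abs_nonneg p.2], by linarith [abs_nonneg p.1]⟩

theorem exists_bound_of_internalPart_mem {w : ℝ × ℝ} (hw : w ≠ 0) (x : ℝ) :
    ∃ M, ∀ β, internalPart w x β ∈ Woct → |embc β.1| ≤ M ∧ |embc β.2| ≤ M := by
  set N := w.1 ^ 2 + w.2 ^ 2 with hN
  have hN0 : N ≠ 0 := by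
    intro h
    apply hw
    ext <;> simp <;> nlinarith [sq_nonneg w.1, sq_nonneg w.2]
  set M₁ := lam * (|w.1| + |w.2|) with hM₁
  have hM₁0 : 0 ≤ M₁ := by unfold M₁ lam; positivity
  set M₂ := M₁ / |N| + M₁ * |x| with hM₂
  have hM₂0 : 0 ≤ M₂ := by positivity
  refine ⟨M₁ + M₂, fun β hβ => ?_⟩
  obtain ⟨h1, h2⟩ := norm_lt_of_mem_Woct hβ
  set p := internalPart w x β with hp
  have e1 : embc β.1 = p.1 * w.2 - p.2 * w.1 := by
    simp only [hp, internalPart, ← hN]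
    field_simp
    rw [hN]; ring
  have e2 : embc β.2 = (p.1 * w.1 + p.2 * w.2) / N - embc β.1 * x := by
    simp only [hp, internalPart, ← hN]
    field_simp
    rw [hN]; ring
  have b1 : |embc β.1| ≤ M₁ := by
    rw [e1]
    refine (abs_sub _ _).trans ?_
    rw [abs_mul, abs_mul, hM₁]
    nlinarith [abs_nonneg w.1, abs_nonneg w.2]
  have b2 : |embc β.2| ≤ M₂ := by
    rw [e2]
    refine (abs_sub _ _).trans ?_
    rw [abs_mul, abs_div, hM₂]
    gcongr
    refine (abs_add_le _ _).trans ?_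
    rw [abs_mul, abs_mul, hM₁]
    nlinarith [abs_nonneg w.1, abs_nonneg w.2]
  exact ⟨by linarith, by linarith⟩

theorem bound_of_inTriangle {t T u x : ℝ} (ht : 0 < t) (htT : t ≤ T) (hu : |u| < 1)
    {β : Zsqrtd 2 × Zsqrtd 2} (h : InTriangle t u x β) :
    |emb β.1| ≤ 2 * T ^ 2 ∧ |emb β.2| ≤ 2 + 2 * T ^ 2 * |x| := by
  obtain ⟨h0, h1, h2⟩ := h
  have e1 : emb β.1 = t ^ 2 * (scaledFst t u x β * u - scaledSnd t u x β) := by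
    simp only [scaledFst, scaledSnd]
    field_simp
    ring
  have e2 : emb β.2 = (scaledFst t u x β + u * scaledSnd t u x β) / (1 + u ^ 2) - emb β.1 * x := by
    simp only [scaledFst, scaledSnd]
    field_simp
    ring
  have hp1 : |scaledFst t u x β| ≤ 1 := by rw [abs_of_pos h0]; exact h1.le
  have hp2 : |scaledSnd t u x β| ≤ 1 := (h2.trans h1).le
  have b1 : |emb β.1| ≤ 2 * T ^ 2 := by
    rw [e1, abs_mul, abs_of_nonneg (by positivity : 0 ≤ t ^ 2)]
    have : |scaledFst t u x β * u - scaledSnd t u x β| ≤ 2 := by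
      refine (abs_sub _ _).trans ?_
      rw [abs_mul]
      nlinarith [abs_nonneg u, abs_nonneg (scaledFst t u x β)]
    have hT : t ^ 2 ≤ T ^ 2 := by gcongr
    nlinarith [sq_nonneg t]
  refine ⟨b1, ?_⟩
  rw [e2]
  refine (abs_sub _ _).trans ?_
  rw [abs_mul]
  gcongr
  rw [abs_div, abs_of_pos (by positivity : 0 < 1 + u ^ 2)]
  refine (div_le_self (abs_nonneg _) (by nlinarith [sq_nonneg u])).trans ?_
  refine (abs_add_le _ _).trans ?_
  rw [abs_mul]
  nlinarith [abs_nonneg u, abs_nonneg (scaledSnd t u x β)]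

/-- The rescaled physical component is off the four lines bounding the unit triangle. -/
def OffBoundary (t u x : ℝ) (β : Zsqrtd 2 × Zsqrtd 2) : Prop :=
  scaledFst t u x β ≠ 0 ∧ scaledFst t u x β ≠ 1 ∧ |scaledSnd t u x β| ≠ scaledFst t u x β

theorem ae_off_affine_zero {a : ℝ} (ha : a ≠ 0) (b : ℝ) :
    ∀ᵐ x : ℝ × ℝ, a * x.1 + b ≠ 0 := by
  rw [ae_iff]
  refine measure_mono_null (t := {-b / a} ×ˢ Set.univ) ?_ ?_
  · intro x hx
    simp only [ne_eq, not_not, Set.mem_ofPred_eq] at hx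
    simp only [Set.mem_prod, Set.mem_singleton_iff, Set.mem_univ, and_true]
    rw [eq_div_iff ha]
    linarith
  · rw [Measure.volume_eq_prod, Measure.prod_prod]
    simp

theorem ae_offBoundary (t : ℝ) {u : ℝ} (hu : |u| < 1) {β : Zsqrtd 2 × Zsqrtd 2} (hβ : β.1 ≠ 0) :
    ∀ᵐ x : ℝ × ℝ, OffBoundary t u x.1 β := by
  have hb := emb_ne_zero hβ
  obtain ⟨hu1, hu2⟩ := abs_lt.1 hu
  set e₁ := u / (t ^ 2 * (1 + u ^ 2)) with he₁
  set e₂ := 1 / (t ^ 2 * (1 + u ^ 2)) with he₂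
  filter_upwards [ae_off_affine_zero hb (emb β.1 * e₁ + emb β.2),
    ae_off_affine_zero hb (emb β.1 * e₁ + emb β.2 - 1),
    ae_off_affine_zero (mul_ne_zero hb (by linarith : u - 1 ≠ 0))
      (emb β.1 * (-e₂ - e₁) + emb β.2 * (u - 1)),
    ae_off_affine_zero (mul_ne_zero hb (by linarith : u + 1 ≠ 0))
      (emb β.1 * (-e₂ + e₁) + emb β.2 * (u + 1))] with x h1 h2 h3 h4
  refine ⟨fun h => h1 ?_, fun h => h2 ?_, fun h => ?_⟩
  · rw [← h, scaledFst]; ring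
  · rw [scaledFst] at h; linarith
  · rcases eq_or_eq_neg_of_abs_eq h with h | h
    · apply h3
      rw [scaledFst, scaledSnd] at h
      linarith
    · apply h4
      rw [scaledFst, scaledSnd] at h
      linarith

theorem continuousAt_scaledFst {t : ℝ} (ht : t ≠ 0) (u x : ℝ) (β : Zsqrtd 2 × Zsqrtd 2) :
    ContinuousAt (fun t => scaledFst t u x β) t := by
  unfold scaledFst
  have : t ^ 2 * (1 + u ^ 2) ≠ 0 := by positivity
  fun_prop (disch := assumption)

theorem continuousAt_scaledSnd {t : ℝ} (ht : t ≠ 0) (u x : ℝ) (β : Zsqrtd 2 × Zsqrtd 2) :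
    ContinuousAt (fun t => scaledSnd t u x β) t := by
  unfold scaledSnd
  have : t ^ 2 * (1 + u ^ 2) ≠ 0 := by positivity
  fun_prop (disch := assumption)

theorem ContinuousAt.eventually_lt_iff {X : Type*} [TopologicalSpace X] {f g : X → ℝ} {a : X}
    (hf : ContinuousAt f a) (hg : ContinuousAt g a) (h : f a ≠ g a) :
    ∀ᶠ y in nhds a, (f y < g y ↔ f a < g a) := by
  rcases h.lt_or_gt with h | h
  · filter_upwards [hf.eventually_lt hg h] with y hy
    exact iff_of_true hy h
  · filter_upwards [hg.eventually_lt hf h] with y hy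
    exact iff_of_false hy.not_gt h.not_gt

theorem eventually_inTriangle_iff {t₀ : ℝ} (ht₀ : t₀ ≠ 0) (u x : ℝ) (β : Zsqrtd 2 × Zsqrtd 2)
    (h : β.1 ≠ 0 → OffBoundary t₀ u x β) :
    ∀ᶠ t in nhds t₀, (InTriangle t u x β ↔ InTriangle t₀ u x β) := by
  by_cases hβ : β.1 = 0
  · simp [InTriangle, scaledFst, scaledSnd, hβ, emb_zero]
  · obtain ⟨h0, h1, h2⟩ := h hβ
    have c1 := continuousAt_scaledFst ht₀ u x β
    have c2 := continuousAt_scaledSnd ht₀ u x β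
    filter_upwards [continuousAt_const.eventually_lt_iff c1 h0.symm,
      c1.eventually_lt_iff continuousAt_const h1, c2.abs.eventually_lt_iff c1 h2] with t a b c
    exact and_congr a (and_congr b c)

theorem eventually_hits_iff {t₀ u : ℝ} (ht₀ : 0 < t₀) (hu : |u| < 1) {w : ℝ × ℝ} (hw : w ≠ 0)
    {x : ℝ × ℝ} (hx : ∀ β : Zsqrtd 2 × Zsqrtd 2, β.1 ≠ 0 → OffBoundary t₀ u x.1 β) :
    ∀ᶠ t in nhds t₀, (Hits t u w x ↔ Hits t₀ u w x) := by
  obtain ⟨M, hM⟩ := exists_bound_of_internalPart_mem hw x.2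
  set T := 2 * t₀ with hT
  set R := max M (max (2 * T ^ 2) (2 + 2 * T ^ 2 * |x.1|)) with hR
  set B : Set (Zsqrtd 2) := {α | |emb α| ≤ R ∧ |embc α| ≤ R} with hB
  have hfin : (B ×ˢ B).Finite := (finite_setOf_abs_emb_le R).prod (finite_setOf_abs_emb_le R)
  have hmem : ∀ t, 0 < t → t ≤ T → ∀ β, InTriangle t u x.1 β → internalPart w x.2 β ∈ Woct →
      β ∈ B ×ˢ B := by
    intro t ht htT β h1 h2
    obtain ⟨a1, a2⟩ := bound_of_inTriangle ht htT hu h1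
    obtain ⟨a3, a4⟩ := hM β h2
    have r1 : M ≤ R := le_max_left _ _
    have r2 : 2 * T ^ 2 ≤ R := (le_max_left _ _).trans (le_max_right _ _)
    have r3 : 2 + 2 * T ^ 2 * |x.1| ≤ R := (le_max_right _ _).trans (le_max_right _ _)
    exact ⟨⟨a1.trans r2, a3.trans r1⟩, ⟨a2.trans r3, a4.trans r1⟩⟩
  have hev : ∀ᶠ t in nhds t₀, ∀ β ∈ B ×ˢ B, (InTriangle t u x.1 β ↔ InTriangle t₀ u x.1 β) :=
    (Filter.eventually_all_finite hfin).2 fun β _ =>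
      eventually_inTriangle_iff ht₀.ne' u x.1 β (hx β)
  filter_upwards [hev, lt_mem_nhds ht₀, gt_mem_nhds (by linarith : t₀ < T)] with t h ht htT
  constructor
  · rintro ⟨β, h1, h2⟩
    exact ⟨β, (h β (hmem t ht htT.le β h1 h2)).1 h1, h2⟩
  · rintro ⟨β, h1, h2⟩
    exact ⟨β, (h β (hmem t₀ ht₀ (by linarith) β h1 h2)).2 h1, h2⟩

theorem countable_zsqrtd : Countable (Zsqrtd 2) := Zsqrtd.injective_re_im.countable

theorem measurable_ind_not_hits (t : ℝ) :
    Measurable fun a : (ℝ × (ℝ × ℝ)) × (ℝ × ℝ) => ind (¬ Hits t a.1.1 a.1.2 a.2) := by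
  classical
  have := countable_zsqrtd
  unfold ind
  refine Measurable.ite ?_ measurable_const measurable_const
  refine MeasurableSet.compl ?_
  have : {a : (ℝ × (ℝ × ℝ)) × (ℝ × ℝ) | Hits t a.1.1 a.1.2 a.2} =
      ⋃ β, {a | InTriangle t a.1.1 a.2.1 β ∧ internalPart a.1.2 a.2.2 β ∈ Woct} := by
    ext a
    simp [Hits]
  change MeasurableSet {a : (ℝ × (ℝ × ℝ)) × (ℝ × ℝ) | Hits t a.1.1 a.1.2 a.2}
  rw [this]
  refine MeasurableSet.iUnion fun β => ?_
  have m1 : Measurable fun a : (ℝ × (ℝ × ℝ)) × (ℝ × ℝ) => scaledFst t a.1.1 a.2.1 β := by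
    unfold scaledFst
    fun_prop
  have m2 : Measurable fun a : (ℝ × (ℝ × ℝ)) × (ℝ × ℝ) => scaledSnd t a.1.1 a.2.1 β := by
    unfold scaledSnd
    fun_prop
  have m3 : Measurable fun a : (ℝ × (ℝ × ℝ)) × (ℝ × ℝ) => (internalPart a.1.2 a.2.2 β).1 := by
    unfold internalPart
    fun_prop
  have m4 : Measurable fun a : (ℝ × (ℝ × ℝ)) × (ℝ × ℝ) => (internalPart a.1.2 a.2.2 β).2 := by
    unfold internalPart
    fun_prop
  refine MeasurableSet.inter ?_ ?_
  · exact (measurableSet_lt measurable_const m1).inter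
      ((measurableSet_lt m1 measurable_const).inter (measurableSet_lt m2.abs m1))
  · exact (measurableSet_lt m3.abs measurable_const).inter
      ((measurableSet_lt m4.abs measurable_const).inter
        (measurableSet_lt (m3.abs.add m4.abs) measurable_const))

theorem volume_Wp_lt_top : volume Wp < ⊤ := by
  refine (measure_mono (t := Metric.closedBall 0 lam) ?_).trans_lt measure_closedBall_lt_top
  intro p hp
  obtain ⟨h1, h2⟩ := norm_lt_of_mem_Woct hp.1
  rw [mem_closedBall_zero_iff, Prod.norm_def]
  exact max_le h1.le h2.le

theorem volume_Fdom_lt_top : volume Fdom < ⊤ := by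
  refine (measure_mono (t := Metric.closedBall 0 4) ?_).trans_lt measure_closedBall_lt_top
  rintro p ⟨r₁, ⟨h1, h1'⟩, r₂, ⟨h2, h2'⟩, rfl⟩
  have hs : Real.sqrt 2 ≤ 2 := by rw [Real.sqrt_le_left (by norm_num)]; norm_num
  have hs0 : 0 ≤ Real.sqrt 2 := Real.sqrt_nonneg 2
  have hm : 0 ≤ r₂ * Real.sqrt 2 := by positivity
  have hm' : r₂ * Real.sqrt 2 ≤ 2 := by nlinarith
  rw [mem_closedBall_zero_iff, Prod.norm_def]
  exact max_le (abs_le.2 ⟨by linarith, by linarith⟩) (abs_le.2 ⟨by linarith, by linarith⟩)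

theorem norm_ind_le_one (P : Prop) : ‖ind P‖ ≤ 1 := by
  unfold ind
  split_ifs <;> simp

/-- The innermost integral in the rescaled form of `F2`. -/
def innerIntegral (t u : ℝ) (w : ℝ × ℝ) : ℝ := ∫ x in Fdom, ind (¬ Hits t u w x)

/-- The rescaled form of `F2`, without its factor `24 / π ^ 4 * t`. -/
def scaledF2 (t : ℝ) : ℝ := ∫ u in Set.Ioo (-1 : ℝ) 1, ∫ w in Wp, innerIntegral t u w

theorem norm_innerIntegral_le (t u : ℝ) (w : ℝ × ℝ) :
    ‖innerIntegral t u w‖ ≤ volume.real Fdom := by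
  refine (norm_setIntegral_le_of_norm_le_const volume_Fdom_lt_top
    fun x _ => norm_ind_le_one _).trans ?_
  simp

theorem norm_integral_innerIntegral_le (t u : ℝ) :
    ‖∫ w in Wp, innerIntegral t u w‖ ≤ volume.real Fdom * volume.real Wp :=
  norm_setIntegral_le_of_norm_le_const volume_Wp_lt_top fun w _ => norm_innerIntegral_le t u w

theorem norm_scaledF2_le (t : ℝ) :
    ‖scaledF2 t‖ ≤ volume.real Fdom * volume.real Wp * volume.real (Set.Ioo (-1 : ℝ) 1) :=
  norm_setIntegral_le_of_norm_le_const (by simp) fun u _ => norm_integral_innerIntegral_le t u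

theorem stronglyMeasurable_innerIntegral (t : ℝ) :
    StronglyMeasurable fun a : ℝ × (ℝ × ℝ) => innerIntegral t a.1 a.2 :=
  (measurable_ind_not_hits t).stronglyMeasurable.integral_prod_right'

theorem continuousAt_innerIntegral {t₀ u : ℝ} (ht₀ : 0 < t₀) (hu : |u| < 1) {w : ℝ × ℝ}
    (hw : w ≠ 0) : ContinuousAt (fun t => innerIntegral t u w) t₀ := by
  have := countable_zsqrtd
  have : IsFiniteMeasure (volume.restrict Fdom) := isFiniteMeasure_restrict.2 volume_Fdom_lt_top.ne
  refine continuousAt_of_dominated (bound := fun _ => 1) (Filter.Eventually.of_forall fun t => ?_)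
    (Filter.Eventually.of_forall fun t => Filter.Eventually.of_forall fun x => norm_ind_le_one _)
    (integrable_const _) ?_
  · exact ((measurable_ind_not_hits t).comp
      (measurable_prodMk_left (x := (u, w)))).aestronglyMeasurable
  · refine ae_restrict_of_ae ?_
    have hx : ∀ᵐ x : ℝ × ℝ, ∀ β : Zsqrtd 2 × Zsqrtd 2, β.1 ≠ 0 → OffBoundary t₀ u x.1 β := by
      rw [ae_all_iff]
      intro β
      by_cases hβ : β.1 = 0
      · simp [hβ]
      · filter_upwards [ae_offBoundary t₀ hu hβ] with x hx _ using hx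
    filter_upwards [hx] with x hx
    refine (continuousAt_const (y := ind (¬ Hits t₀ u w x))).congr ?_
    filter_upwards [eventually_hits_iff ht₀ hu hw hx] with t h
    rw [h]

theorem continuousAt_integral_innerIntegral {t₀ u : ℝ} (ht₀ : 0 < t₀) (hu : |u| < 1) :
    ContinuousAt (fun t => ∫ w in Wp, innerIntegral t u w) t₀ := by
  have : IsFiniteMeasure (volume.restrict Wp) := isFiniteMeasure_restrict.2 volume_Wp_lt_top.ne
  refine continuousAt_of_dominated (bound := fun _ => volume.real Fdom)
    (Filter.Eventually.of_forall fun t => ?_)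
    (Filter.Eventually.of_forall fun t => Filter.Eventually.of_forall fun w =>
      norm_innerIntegral_le t u w) (integrable_const _) ?_
  · exact ((stronglyMeasurable_innerIntegral t).comp_measurable
      (measurable_prodMk_left (x := u))).aestronglyMeasurable
  · refine ae_restrict_of_ae ?_
    filter_upwards [Measure.ae_ne volume (0 : ℝ × ℝ)] with w hw
    exact continuousAt_innerIntegral ht₀ hu hw

theorem continuousAt_scaledF2 {t₀ : ℝ} (ht₀ : 0 < t₀) : ContinuousAt scaledF2 t₀ := by
  refine continuousAt_of_dominated (bound := fun _ => volume.real Fdom * volume.real Wp)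
    (Filter.Eventually.of_forall fun t => ?_)
    (Filter.Eventually.of_forall fun t => Filter.Eventually.of_forall fun u =>
      norm_integral_innerIntegral_le t u) (integrable_const _) ?_
  · exact (stronglyMeasurable_innerIntegral t).integral_prod_right'.aestronglyMeasurable
  · filter_upwards [ae_restrict_mem measurableSet_Ioo] with u hu
    exact continuousAt_integral_innerIntegral ht₀ (abs_lt.2 hu)

theorem setIntegral_Ioo_eq_mul {t : ℝ} (ht : 0 ≤ t) (f : ℝ → ℝ) :
    ∫ z in Set.Ioo (-t) t, f z = t * ∫ u in Set.Ioo (-1 : ℝ) 1, f (t * u) := by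
  rw [← integral_Ioc_eq_integral_Ioo, ← integral_Ioc_eq_integral_Ioo,
    ← intervalIntegral.integral_of_le (by linarith), ← intervalIntegral.integral_of_le (by norm_num),
    intervalIntegral.mul_integral_comp_mul_left]
  simp

theorem F2_zero : F2 0 = 0 := by
  simp [F2]

theorem F2_eq {t : ℝ} (ht : 0 ≤ t) : F2 t = 24 / Real.pi ^ 4 * (t * scaledF2 t) := by
  rcases ht.eq_or_lt with rfl | ht
  · simp [F2_zero]
  · rw [F2, setIntegral_Ioo_eq_mul ht.le]
    simp only [inter_Tprime_eq_empty_iff ht, scaledF2, innerIntegral]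

theorem continuousAt_mul_scaledF2 {t : ℝ} (ht : 0 ≤ t) :
    ContinuousAt (fun t => t * scaledF2 t) t := by
  rcases ht.eq_or_lt with rfl | ht
  · rw [ContinuousAt, zero_mul]
    exact Filter.Tendsto.zero_mul_isBoundedUnder_le Filter.tendsto_id
      (Filter.isBoundedUnder_of ⟨_, norm_scaledF2_le⟩)
  · exact continuousAt_id.mul (continuousAt_scaledF2 ht)

theorem stmt10 : F2 0 = 0 ∧ ContinuousOn F2 (Set.Ici 0) := by
  refine ⟨F2_zero, ContinuousOn.congr (fun t ht => ?_) fun t ht => F2_eq ht⟩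
  exact ((continuousAt_mul_scaledF2 ht).const_mul _).continuousWithinAt

end
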